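/- arXiv:2004.09041 — 2 statements merged into one kernel-verified Lean document; each statement's English description precedes it below -/
import Mathlib

section
/- Let ν ∈ O_K. If ν ≡ 7 (mod π₂³) or ν ≡ 7 (mod π₂'³), then ν is not a sum of three squares in O_K (i.e., there are no x, y, z ∈ O_K with x² + y² + z² = ν). -/
/-!
Statements about sums of squares in K = ℚ(√17), with ring of integers
O_K = ℤ[ω], ω = (1+√17)/2, realized as ℤ[X]/(X² − X − 4).
-/

noncomputable section

namespace Paper17

open Polynomial

/-- The ring of integers ℤ[ω] of ℚ(√17), ω = (1+√17)/2, as ℤ[X]/(X² − X − 4). -/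
abbrev O17 : Type := AdjoinRoot (X ^ 2 - X - C 4 : ℤ[X])

/-- ω = (1+√17)/2 as an element of O17. -/
def ω : O17 := AdjoinRoot.root _

lemma hroot : (X ^ 2 - X - C 4 : ℤ[X]).eval₂ (Int.castRingHom ℝ)
    ((1 + Real.sqrt 17) / 2) = 0 := by
  have h : Real.sqrt 17 ^ 2 = 17 := Real.sq_sqrt (by norm_num)
  simp only [eval₂_sub, eval₂_pow, eval₂_X, eval₂_C, eval₂_ofNat, map_ofNat]
  nlinarith [h]

lemma hroot' : (X ^ 2 - X - C 4 : ℤ[X]).eval₂ (Int.castRingHom ℝ)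
    ((1 - Real.sqrt 17) / 2) = 0 := by
  have h : Real.sqrt 17 ^ 2 = 17 := Real.sq_sqrt (by norm_num)
  simp only [eval₂_sub, eval₂_pow, eval₂_X, eval₂_C, eval₂_ofNat, map_ofNat]
  nlinarith [h]

/-- The real embedding sending ω to (1+√17)/2. -/
def emb1 : O17 →+* ℝ := AdjoinRoot.lift (Int.castRingHom ℝ) ((1 + Real.sqrt 17) / 2) hroot

/-- The real embedding sending ω to (1−√17)/2. -/
def emb2 : O17 →+* ℝ := AdjoinRoot.lift (Int.castRingHom ℝ) ((1 - Real.sqrt 17) / 2) hroot'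

/-- An element of O_K is totally positive if its images under both real embeddings
are positive. -/
def TotPos (x : O17) : Prop := 0 < emb1 x ∧ 0 < emb2 x

/-- π₂ = (5+√17)/2 = 2 + ω. -/
def pi2 : O17 := 2 + ω

/-- π₂' = (5−√17)/2 = 3 − ω. -/
def pi2' : O17 := 3 - ω

/-- The ring homomorphism `O17 → ℤ/8ℤ` sending `ω` to a root `r` of `X² − X − 4` modulo `8`. -/
def toZMod8 (r : ZMod 8) (hr : r ^ 2 - r - 4 = 0) : O17 →+* ZMod 8 :=
  AdjoinRoot.lift (Int.castRingHom (ZMod 8)) r (by simpa [eval₂_sub] using hr)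

lemma toZMod8_omega (r : ZMod 8) (hr : r ^ 2 - r - 4 = 0) : toZMod8 r hr ω = r :=
  AdjoinRoot.lift_root _

lemma zmod8_sum_three_squares_ne_seven :
    ∀ x y z : ZMod 8, x ^ 2 + y ^ 2 + z ^ 2 ≠ 7 := by
  decide

lemma sum_three_squares_ne_of_map_eq_seven {R : Type*} [CommRing R] (f : R →+* ZMod 8) {ν p : R}
    (hp : f p = 0) (h : p ∣ ν - 7) : ¬ ∃ x y z : R, x ^ 2 + y ^ 2 + z ^ 2 = ν := by
  rintro ⟨x, y, z, rfl⟩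
  have h0 := map_dvd f h
  rw [hp, zero_dvd_iff, map_sub, sub_eq_zero] at h0
  exact zmod8_sum_three_squares_ne_seven (f x) (f y) (f z) (by simpa [map_ofNat f 7] using h0)

/-- If ν ≡ 7 (mod π₂³) or ν ≡ 7 (mod π₂'³), then ν is not a sum of
three squares in O_K. -/
theorem not_sum_three_squares (ν : O17)
    (h : pi2 ^ 3 ∣ (ν - 7) ∨ pi2' ^ 3 ∣ (ν - 7)) :
    ¬ ∃ x y z : O17, x ^ 2 + y ^ 2 + z ^ 2 = ν := by
  rcases h with h | h
  · refine sum_three_squares_ne_of_map_eq_seven (toZMod8 4 (by decide)) ?_ h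
    rw [pi2, map_pow, map_add, toZMod8_omega, map_ofNat]
    decide
  · refine sum_three_squares_ne_of_map_eq_seven (toZMod8 5 (by decide)) ?_ h
    rw [pi2', map_pow, map_sub, toZMod8_omega, map_ofNat]
    decide

end Paper17
end
end

section
/- For every totally positive ν ∈ O_K, r_{3,K}(π₂²·ν) = r_{3,K}(ν) and r_{3,K}(π₂'²·ν) = r_{3,K}(ν). -/
/-!
Statements about sums of squares in K = ℚ(√17), with ring of integers
O_K = ℤ[ω], ω = (1+√17)/2, realized as ℤ[X]/(X² − X − 4).
-/

noncomputable section

namespace Paper17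

open Polynomial

/-- `r3 ν` is the number of triples (x₁,x₂,x₃) ∈ O_K³ with x₁² + x₂² + x₃² = ν. -/
def r3 (ν : O17) : ℕ :=
  Set.ncard {t : O17 × O17 × O17 | t.1 ^ 2 + t.2.1 ^ 2 + t.2.2 ^ 2 = ν}

lemma ω_sq : ω ^ 2 = ω + 4 := by
  have h : AdjoinRoot.mk (X ^ 2 - X - C 4 : ℤ[X]) (X ^ 2 - X - C 4) = 0 := AdjoinRoot.mk_self
  simp only [map_sub, map_pow, AdjoinRoot.mk_X, AdjoinRoot.mk_C] at h
  have h4 : AdjoinRoot.of (X ^ 2 - X - C 4 : ℤ[X]) 4 = 4 := map_ofNat _ 4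
  rw [h4] at h
  unfold ω
  linear_combination h

lemma pi2_mul_pi2' : pi2 * pi2' = 2 := by
  unfold pi2 pi2'
  linear_combination -ω_sq

lemma monic_poly : (X ^ 2 - X - C 4 : ℤ[X]).Monic := by
  monicity!

lemma isLeftRegular_two : IsLeftRegular (2 : O17) := by
  have : Module.Free ℤ O17 := monic_poly.free_adjoinRoot
  intro x y h
  have h' : (2 : ℤ) • x = (2 : ℤ) • y := by
    simpa only [zsmul_eq_mul, Int.cast_ofNat] using h
  exact smul_right_injective O17 (two_ne_zero : (2 : ℤ) ≠ 0) h'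

/-- If `p` divides `ω - c`, every element is congruent to a rational integer modulo `p`. -/
lemma exists_int_dvd_sub {p : O17} {c : ℤ} (hp : p ∣ ω - c) (x : O17) :
    ∃ n : ℤ, p ∣ x - n := by
  induction x using AdjoinRoot.induction_on with
  | ih f =>
    refine ⟨f.eval c, hp.trans ?_⟩
    have h := Polynomial.sub_dvd_eval_sub ω (c : O17) (f.map (Int.castRingHom O17))
    rw [Polynomial.eval_intCast_map, Polynomial.eval_map] at h
    have h1 : f.eval₂ (Int.castRingHom O17) ω
        = AdjoinRoot.mk (X ^ 2 - X - C 4 : ℤ[X]) f := by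
      rw [← AdjoinRoot.aeval_eq, Polynomial.aeval_def]
      rfl
    rw [h1] at h
    simpa using h

/-- The ring homomorphism to `ℤ/4ℤ` sending `ω` to a root `c` of `X² - X`. -/
def toZMod4 (c : ZMod 4) (hc : c ^ 2 - c = 0) : O17 →+* ZMod 4 :=
  AdjoinRoot.lift (Int.castRingHom (ZMod 4)) c (by
    have h4 : (4 : ZMod 4) = 0 := by decide
    simp [eval₂_sub, hc, h4])

lemma toZMod4_ω (c : ZMod 4) (hc : c ^ 2 - c = 0) : toZMod4 c hc ω = c :=
  AdjoinRoot.lift_root _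

lemma ZMod4.two_mul_eq_zero_of_sum_sq (a b c : ZMod 4) (h : a ^ 2 + b ^ 2 + c ^ 2 = 0) :
    2 * a = 0 ∧ 2 * b = 0 ∧ 2 * c = 0 := by
  revert a b c
  decide

lemma r3_sq_mul {p : O17} (h2 : p ∣ 2) {c : ℤ} (hpc : p ∣ ω - c)
    (φ : O17 →+* ZMod 4) (hφ : φ p = 2) (ν : O17) : r3 (p ^ 2 * ν) = r3 ν := by
  have hreg : IsLeftRegular p := by
    obtain ⟨q, hq⟩ := h2
    refine IsLeftRegular.of_mul (a := q) ?_
    rw [mul_comm, ← hq]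
    exact isLeftRegular_two
  have hdvd (x : O17) (hx : 2 * φ x = 0) : p ∣ x := by
    obtain ⟨n, y, hy⟩ := exists_int_dvd_sub hpc x
    have hxn : x = n + p * y := by linear_combination hy
    have hn : ((2 * n : ℤ) : ZMod 4) = 0 := by
      rw [hxn, map_add, map_mul, map_intCast, hφ] at hx
      have h4 : (4 : ZMod 4) = 0 := by decide
      push_cast
      linear_combination hx - φ y * h4
    rw [ZMod.intCast_zmod_eq_zero_iff_dvd] at hn
    obtain ⟨m, rfl⟩ : (2 : ℤ) ∣ n := by omega
    rw [hxn]
    push_cast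
    exact dvd_add (h2.mul_right _) (dvd_mul_right _ _)
  unfold r3
  symm
  refine Set.ncard_congr (fun t _ ↦ (p * t.1, p * t.2.1, p * t.2.2)) ?_ ?_ ?_
  · rintro ⟨x, y, z⟩ h
    simp only [Set.mem_ofPred_eq] at h ⊢
    linear_combination p ^ 2 * h
  · rintro ⟨x, y, z⟩ ⟨x', y', z'⟩ - - h
    simp only [Prod.mk.injEq] at h ⊢
    exact ⟨hreg h.1, hreg h.2.1, hreg h.2.2⟩
  · rintro ⟨x, y, z⟩ h
    simp only [Set.mem_ofPred_eq] at h
    have hmod : φ x ^ 2 + φ y ^ 2 + φ z ^ 2 = 0 := by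
      have h4 : (2 : ZMod 4) ^ 2 = 0 := by decide
      simpa [hφ, h4] using congrArg φ h
    obtain ⟨hx, hy, hz⟩ := ZMod4.two_mul_eq_zero_of_sum_sq _ _ _ hmod
    obtain ⟨x, rfl⟩ := hdvd x hx
    obtain ⟨y, rfl⟩ := hdvd y hy
    obtain ⟨z, rfl⟩ := hdvd z hz
    refine ⟨(x, y, z), hreg.pow 2 ?_, rfl⟩
    change p ^ 2 * (x ^ 2 + y ^ 2 + z ^ 2) = p ^ 2 * ν
    linear_combination h

/-- For every totally positive ν ∈ O_K,
r_{3,K}(π₂²·ν) = r_{3,K}(ν) and r_{3,K}(π₂'²·ν) = r_{3,K}(ν). -/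
theorem r3_invariance (ν : O17) (hpos : TotPos ν) :
    r3 (pi2 ^ 2 * ν) = r3 ν ∧ r3 (pi2' ^ 2 * ν) = r3 ν := by
  constructor
  · refine r3_sq_mul ⟨pi2', pi2_mul_pi2'.symm⟩ (c := -2) ⟨1, ?_⟩ (toZMod4 0 (by decide)) ?_ ν
    · unfold pi2
      push_cast
      ring
    · rw [pi2, map_add, map_ofNat, toZMod4_ω]
      decide
  · refine r3_sq_mul ⟨pi2, ?_⟩ (c := 3) ⟨-1, ?_⟩ (toZMod4 1 (by decide)) ?_ ν
    · rw [mul_comm, pi2_mul_pi2']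
    · unfold pi2'
      push_cast
      ring
    · rw [pi2', map_sub, map_ofNat, toZMod4_ω]
      decide

end Paper17
end
end
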